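/- arXiv:1701.04862 — 7 statements merged into one kernel-verified Lean document; each statement's English description precedes it below -/
import Mathlib

section
/- Let g : ℝ^m → ℝ^d be a function given as a finite composition of affine maps and coordinatewise nonlinearities, where each nonlinearity is either a (leaky) rectifier x ↦ c₁·x·1[x<0] + c₂·x·1[x≥0] (for real constants c₁, c₂) or a C^∞ strictly increasing function with everywhere positive derivative. If m < d, then the image g(ℝ^m) is a Lebesgue-null set in ℝ^d. -/
open MeasureTheory

/-- A (leaky) rectifier nonlinearity `x ↦ c₁·x·1[x<0] + c₂·x·1[x≥0]`. -/
def IsLeakyRectifier (σ : ℝ → ℝ) : Prop :=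
  ∃ c₁ c₂ : ℝ, ∀ x : ℝ, σ x = if x < 0 then c₁ * x else c₂ * x

/-- A `C^∞` strictly increasing nonlinearity with everywhere positive derivative. -/
def IsSmoothStrictlyIncreasing (σ : ℝ → ℝ) : Prop :=
  ContDiff ℝ (⊤ : ℕ∞) σ ∧ StrictMono σ ∧ ∀ x : ℝ, 0 < deriv σ x

/-- `NNComp m d g` says that `g : ℝ^m → ℝ^d` is a finite composition of affine maps
and coordinatewise nonlinearities, each nonlinearity being either a (leaky) rectifier
or a smooth strictly increasing function. -/
inductive NNComp : (m d : ℕ) → ((Fin m → ℝ) → (Fin d → ℝ)) → Prop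
  | id (m : ℕ) : NNComp m m id
  | affine {m k d : ℕ} (W : Matrix (Fin d) (Fin k) ℝ) (b : Fin d → ℝ)
      {f : (Fin m → ℝ) → (Fin k → ℝ)} (hf : NNComp m k f) :
      NNComp m d (fun z => W.mulVec (f z) + b)
  | activation {m k : ℕ} (σ : ℝ → ℝ)
      (hσ : IsLeakyRectifier σ ∨ IsSmoothStrictlyIncreasing σ)
      {f : (Fin m → ℝ) → (Fin k → ℝ)} (hf : NNComp m k f) :
      NNComp m k (fun z i => σ (f z i))

/-- A leaky rectifier is locally Lipschitz. -/
theorem IsLeakyRectifier.locallyLipschitz {σ : ℝ → ℝ} (hσ : IsLeakyRectifier σ) :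
    LocallyLipschitz σ := by
  obtain ⟨c₁, c₂, h⟩ := hσ
  have hσ_eq : σ = fun x => c₁ * min x 0 + c₂ * max x 0 := by
    funext x
    rw [h x]
    split_ifs with hx
    · simp [min_eq_left hx.le, max_eq_right hx.le]
    · simp [min_eq_right (not_lt.mp hx), max_eq_left (not_lt.mp hx)]
  have hmul (c : ℝ) : LipschitzWith ‖c‖₊ (fun x : ℝ => c * x) := lipschitzWith_smul c
  rw [hσ_eq]
  exact (((hmul c₁).comp (LipschitzWith.id.min_const 0)).add
    ((hmul c₂).comp (LipschitzWith.id.max_const 0))).locallyLipschitz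

/-- A smooth strictly increasing function is locally Lipschitz. -/
theorem IsSmoothStrictlyIncreasing.locallyLipschitz {σ : ℝ → ℝ}
    (hσ : IsSmoothStrictlyIncreasing σ) : LocallyLipschitz σ :=
  (hσ.1.of_le (by exact_mod_cast le_top)).locallyLipschitz

/-- Applying a locally Lipschitz function to every coordinate is locally Lipschitz. -/
theorem LocallyLipschitz.coordinatewise {ι : Type*} [Fintype ι] {σ : ℝ → ℝ}
    (hσ : LocallyLipschitz σ) : LocallyLipschitz (fun (x : ι → ℝ) i => σ (x i)) := by
  intro x
  choose K t ht hK using fun i => hσ (x i)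
  refine ⟨Finset.univ.sup K, Set.pi Set.univ t,
    set_pi_mem_nhds Set.finite_univ fun i _ => ht i, fun y hy z hz => ?_⟩
  refine edist_pi_le_iff.mpr fun i => (hK i (hy i trivial) (hz i trivial)).trans ?_
  gcongr
  · exact Finset.le_sup (Finset.mem_univ i)
  · exact edist_le_pi_edist y z i

/-- A finite composition of affine maps and admissible coordinatewise nonlinearities is
locally Lipschitz. -/
theorem NNComp.locallyLipschitz {m d : ℕ} {g : (Fin m → ℝ) → (Fin d → ℝ)}
    (hg : NNComp m d g) : LocallyLipschitz g := by
  induction hg with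
  | id => exact LocallyLipschitz.id
  | affine W b _ ih =>
    have hW : ContDiff ℝ 1 (fun x => W.mulVec x + b) :=
      (Matrix.mulVecLin W).toContinuousLinearMap.contDiff.add contDiff_const
    exact hW.locallyLipschitz.comp ih
  | activation σ hσ _ ih =>
    have hσ_lip : LocallyLipschitz σ :=
      hσ.elim IsLeakyRectifier.locallyLipschitz IsSmoothStrictlyIncreasing.locallyLipschitz
    exact hσ_lip.coordinatewise.comp ih

/-- The range of a locally Lipschitz map into a space of larger dimension is Lebesgue-null. -/
theorem LocallyLipschitz.volume_range_eq_zero {m d : ℕ} {g : (Fin m → ℝ) → (Fin d → ℝ)}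
    (hg : LocallyLipschitz g) (hmd : m < d) : volume (Set.range g) = 0 := by
  have hdim : dimH (Set.range g) < ((d : NNReal) : ENNReal) :=
    calc dimH (Set.range g) ≤ dimH (Set.univ : Set (Fin m → ℝ)) :=
          dimH_range_le_of_locally_lipschitzOn hg
      _ = m := Real.dimH_univ_pi_fin m
      _ < ((d : NNReal) : ENNReal) := by exact_mod_cast hmd
  have hnull := hausdorffMeasure_of_dimH_lt hdim
  rw [← hausdorffMeasure_pi_real]
  simpa using hnull

/-- If `g : ℝ^m → ℝ^d` is a finite composition of affine maps and admissible coordinatewise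
nonlinearities, and `m < d`, then the image `g(ℝ^m)` is Lebesgue-null in `ℝ^d`. -/
theorem image_of_neural_net_null {m d : ℕ} (g : (Fin m → ℝ) → (Fin d → ℝ))
    (hg : NNComp m d g) (hmd : m < d) :
    volume (Set.range g) = 0 := by
  exact hg.locallyLipschitz.volume_range_eq_zero hmd
end

section
/- Let M and P be nonempty disjoint compact subsets of ℝ^d. Then there exists a C^∞ function D* : ℝ^d → [0,1] that is identically 1 on a neighbourhood of M and identically 0 on a neighbourhood of P; consequently, for any probability measures P_r supported in M and P_g supported in P, the discriminator D* has accuracy 1, the gradient ∇D*(x) = 0 for every x ∈ M ∪ P, and D* maximizes L(D) = E_{x∼P_r}[log D(x)] + E_{x∼P_g}[log(1−D(x))] over all measurable D : ℝ^d → [0,1] (with L(D*) = 0). -/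
open MeasureTheory

/-- The GAN discriminator objective
`L(D) = E_{x∼P_r}[log D(x)] + E_{x∼P_g}[log(1−D(x))]`. -/
noncomputable def ganObjective {d : ℕ}
    (Pr Pg : Measure (EuclideanSpace ℝ (Fin d)))
    (D : EuclideanSpace ℝ (Fin d) → ℝ) : ℝ :=
  (∫ x, Real.log (D x) ∂Pr) + ∫ x, Real.log (1 - D x) ∂Pg

lemma ganObjective_nonpos {d : ℕ} (Pr Pg : Measure (EuclideanSpace ℝ (Fin d)))
    {D : EuclideanSpace ℝ (Fin d) → ℝ} (hD : ∀ x, D x ∈ Set.Icc (0 : ℝ) 1) :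
    ganObjective Pr Pg D ≤ 0 :=
  add_nonpos
    (integral_nonpos fun x => Real.log_nonpos (hD x).1 (hD x).2)
    (integral_nonpos fun x =>
      Real.log_nonpos (sub_nonneg.2 (hD x).2) (sub_le_self 1 (hD x).1))

lemma ganObjective_eq_zero {d : ℕ} {Pr Pg : Measure (EuclideanSpace ℝ (Fin d))}
    {D : EuclideanSpace ℝ (Fin d) → ℝ} (hr : ∀ᵐ x ∂Pr, D x = 1) (hg : ∀ᵐ x ∂Pg, D x = 0) :
    ganObjective Pr Pg D = 0 := by
  have h₁ : ∫ x, Real.log (D x) ∂Pr = 0 :=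
    integral_eq_zero_of_ae (hr.mono fun x hx => by simp [hx])
  have h₂ : ∫ x, Real.log (1 - D x) ∂Pg = 0 :=
    integral_eq_zero_of_ae (hg.mono fun x hx => by simp [hx])
  rw [ganObjective, h₁, h₂, add_zero]

/-- Smooth Urysohn lemma on `ℝ^d`, with constancy on neighbourhoods of the closed sets. -/
lemma exists_contDiff_zero_one_nhdsSet {d : ℕ} {s t : Set (EuclideanSpace ℝ (Fin d))}
    (hs : IsClosed s) (ht : IsClosed t) (hst : Disjoint s t) :
    ∃ f : EuclideanSpace ℝ (Fin d) → ℝ, ContDiff ℝ (⊤ : ℕ∞) f ∧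
      (∀ x, f x ∈ Set.Icc (0 : ℝ) 1) ∧
      (∃ U, IsOpen U ∧ s ⊆ U ∧ Set.EqOn f 0 U) ∧ ∃ V, IsOpen V ∧ t ⊆ V ∧ Set.EqOn f 1 V := by
  obtain ⟨f, hf0, hf1, hf⟩ := exists_contMDiffMap_zero_one_nhds_of_isClosed (n := (⊤ : ℕ∞))
    (modelWithCornersSelf ℝ (EuclideanSpace ℝ (Fin d))) hs ht hst
  obtain ⟨U, hU, hsU, hfU⟩ := eventually_nhdsSet_iff_exists.1 hf0
  obtain ⟨V, hV, htV, hfV⟩ := eventually_nhdsSet_iff_exists.1 hf1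
  exact ⟨f, f.contMDiff.contDiff, hf, ⟨U, hU, hsU, hfU⟩, V, hV, htV, hfV⟩

lemma Set.EqOn.fderiv_eq_zero_of_isOpen {E : Type*} [NormedAddCommGroup E] [NormedSpace ℝ E]
    {f : E → ℝ} {U : Set E} {c : ℝ} (h : Set.EqOn f (fun _ => c) U) (hU : IsOpen U) {x : E}
    (hx : x ∈ U) : fderiv ℝ f x = 0 := by
  rw [(h.eventuallyEq_of_mem (hU.mem_nhds hx)).fderiv_eq, fderiv_fun_const, Pi.zero_apply]

/-- **Perfect discrimination for disjoint compact supports.**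
If `M` and `P` are nonempty disjoint compact subsets of `ℝ^d`, then there is a `C^∞`
discriminator `D* : ℝ^d → [0,1]` which is identically `1` on a neighbourhood of `M` and
identically `0` on a neighbourhood of `P`; consequently for all probability measures `P_r`
supported in `M` and `P_g` supported in `P`, `D*` has accuracy 1, has vanishing gradient at
every point of `M ∪ P`, and maximizes the objective `L` over all measurable discriminators
with values in `[0,1]`, with `L(D*) = 0`. -/
theorem perfect_discriminator_disjoint_compact {d : ℕ}
    (M P : Set (EuclideanSpace ℝ (Fin d)))
    (hMc : IsCompact M) (hPc : IsCompact P)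
    (hMne : M.Nonempty) (hPne : P.Nonempty)
    (hdisj : Disjoint M P) :
    ∃ Dstar : EuclideanSpace ℝ (Fin d) → ℝ,
      ContDiff ℝ (⊤ : ℕ∞) Dstar ∧
      (∀ x, Dstar x ∈ Set.Icc (0 : ℝ) 1) ∧
      (∃ U : Set (EuclideanSpace ℝ (Fin d)), IsOpen U ∧ M ⊆ U ∧ Set.EqOn Dstar 1 U) ∧
      (∃ V : Set (EuclideanSpace ℝ (Fin d)), IsOpen V ∧ P ⊆ V ∧ Set.EqOn Dstar 0 V) ∧
      (∀ x ∈ M ∪ P, fderiv ℝ Dstar x = 0) ∧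
      (∀ Pr Pg : Measure (EuclideanSpace ℝ (Fin d)),
        IsProbabilityMeasure Pr → IsProbabilityMeasure Pg →
        Pr M = 1 → Pg P = 1 →
          (Pr {x | Dstar x = 1} = 1 ∧ Pg {x | Dstar x = 0} = 1) ∧
          (∀ D : EuclideanSpace ℝ (Fin d) → ℝ, Measurable D →
            (∀ x, D x ∈ Set.Icc (0 : ℝ) 1) →
            ganObjective Pr Pg D ≤ ganObjective Pr Pg Dstar) ∧
          ganObjective Pr Pg Dstar = 0) := by
  obtain ⟨f, hf, hf01, ⟨V, hV, hPV, hfV⟩, U, hU, hMU, hfU⟩ :=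
    exists_contDiff_zero_one_nhdsSet hPc.isClosed hMc.isClosed hdisj.symm
  refine ⟨f, hf, hf01, ⟨U, hU, hMU, hfU⟩, ⟨V, hV, hPV, hfV⟩, ?_, ?_⟩
  · rintro x (hx | hx)
    · exact Set.EqOn.fderiv_eq_zero_of_isOpen hfU hU (hMU hx)
    · exact Set.EqOn.fderiv_eq_zero_of_isOpen hfV hV (hPV hx)
  · intro Pr Pg _ _ hPr hPg
    have hr : ∀ᵐ x ∂Pr, f x = 1 :=
      Filter.mem_of_superset ((mem_ae_iff_prob_eq_one hMc.measurableSet).2 hPr) fun x hx =>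
        hfU (hMU hx)
    have hg : ∀ᵐ x ∂Pg, f x = 0 :=
      Filter.mem_of_superset ((mem_ae_iff_prob_eq_one hPc.measurableSet).2 hPg) fun x hx =>
        hfV (hPV hx)
    have hL := ganObjective_eq_zero hr hg
    refine ⟨⟨?_, ?_⟩, fun D _ hD => (ganObjective_nonpos Pr Pg hD).trans_eq hL.symm, hL⟩
    · rw [measure_congr (Filter.eventuallyEq_univ.2 hr), measure_univ]
    · rw [measure_congr (Filter.eventuallyEq_univ.2 hg), measure_univ]
end

section
/- Let μ, ρ, ν be probability measures on ℝ^d that are absolutely continuous with everywhere positive densities p_μ, p_ρ, p_ν with respect to Lebesgue measure, and let D*(x) = p_ρ(x)/(p_ρ(x) + p_ν(x)). Then KL(μ ‖ ρ) = −E_{x∼μ}[log(D*(x)/(1 − D*(x)))] + KL(μ ‖ ν). In particular, with μ = P_{g_θ}, ρ = P_r, ν = P_{g_{θ₀}}, one has KL(P_{g_θ} ‖ P_r) = −E_{x∼P_{g_θ}}[log(D*(x)/(1 − D*(x)))] + KL(P_{g_θ} ‖ P_{g_{θ₀}}), where D* = P_r/(P_r + P_{g_{θ₀}}) is the optimal discriminator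 fixed at θ₀. -/
open MeasureTheory

/-- The odds associated with the proportion `a / (a + b)` are `a / b`. -/
lemma odds_div_add {a b : ℝ} (ha : 0 < a) (hb : 0 < b) :
    a / (a + b) / (1 - a / (a + b)) = a / b := by
  have hab : a + b ≠ 0 := (add_pos ha hb).ne'
  rw [one_sub_div hab, add_sub_cancel_left, div_div_div_cancel_right₀ hab]

/-- **KL decomposition through the optimal discriminator.**
Let `μ, ρ, ν` be probability measures on `ℝ^d` with everywhere positive Lebesgue densities
`pμ, pρ, pν`, and let `D*(x) = pρ(x)/(pρ(x) + pν(x))`. Then (with KL written via densities,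
`KL(μ‖ρ) = E_{x∼μ}[log(pμ(x)/pρ(x))]`)
`KL(μ‖ρ) = −E_{x∼μ}[log(D*(x)/(1 − D*(x)))] + KL(μ‖ν)`.
In particular, with `μ = P_{g_θ}`, `ρ = P_r`, `ν = P_{g_{θ₀}}`, this is the identity
`KL(P_{g_θ}‖P_r) = −E_{x∼P_{g_θ}}[log(D*(x)/(1 − D*(x)))] + KL(P_{g_θ}‖P_{g_{θ₀}})`
for the optimal discriminator `D* = P_r/(P_r + P_{g_{θ₀}})` fixed at `θ₀`. -/
theorem kl_eq_neg_logit_add_kl {d : ℕ}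
    (μ ρ ν : Measure (EuclideanSpace ℝ (Fin d)))
    [IsProbabilityMeasure μ] [IsProbabilityMeasure ρ] [IsProbabilityMeasure ν]
    (pμ pρ pν : EuclideanSpace ℝ (Fin d) → ℝ)
    (hpμ_pos : ∀ x, 0 < pμ x) (hpρ_pos : ∀ x, 0 < pρ x) (hpν_pos : ∀ x, 0 < pν x)
    (hμ : μ = volume.withDensity fun x => ENNReal.ofReal (pμ x))
    (hρ : ρ = volume.withDensity fun x => ENNReal.ofReal (pρ x))
    (hν : ν = volume.withDensity fun x => ENNReal.ofReal (pν x))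
    (Dstar : EuclideanSpace ℝ (Fin d) → ℝ)
    (hD : ∀ x, Dstar x = pρ x / (pρ x + pν x))
    (hint_logit : Integrable (fun x => Real.log (Dstar x / (1 - Dstar x))) μ)
    (hint_kl_ν : Integrable (fun x => Real.log (pμ x / pν x)) μ) :
    ∫ x, Real.log (pμ x / pρ x) ∂μ =
      -(∫ x, Real.log (Dstar x / (1 - Dstar x)) ∂μ) + ∫ x, Real.log (pμ x / pν x) ∂μ := by
  rw [neg_add_eq_sub, ← integral_sub hint_kl_ν hint_logit]
  congr 1 with x
  rw [hD x, odds_div_add (hpρ_pos x) (hpν_pos x),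
    Real.log_div (hpμ_pos x).ne' (hpρ_pos x).ne', Real.log_div (hpρ_pos x).ne' (hpν_pos x).ne',
    Real.log_div (hpμ_pos x).ne' (hpν_pos x).ne']
  ring
end

section
/- Let P_r and P_g be probability measures on ℝ^d with supports contained in sets M and P respectively, let ε ∼ N(0, σ²I) with Gaussian density P_ε, and let P_{r+ε}(x) = ∫ P_ε(x − y) dP_r(y) and P_{g+ε}(x) = ∫ P_ε(x − y) dP_g(y) be the (everywhere positive) smoothed densities. Let D*(x) = P_{r+ε}(x)/(P_{r+ε}(x) + P_{g+ε}(x)) be the optimal discriminator between the noisy distributions. Define a(x) = (1/(2σ²))·1/(P_{g+ε}(x) + P_{r+ε}(x)) and b(x) = a(x)·P_{r+ε}(x)/P_{g+ε}(x). Then for every x ∈ ℝ^d: ∇_x log(1 − D*(x)) = a(x) ∫_M P_ε(x − y) ∇_x‖x − y‖² dP_r(y) − b(x) ∫_P P_ε(x − y) ∇_x‖x − y‖² dP_g(y); moreover a(x) > 0 and b(x) > 0 for all x, and b(x) > a(x) if and only if P_{r+ε}(x) > P_{g+ε}(x), while b(x) < a(x) if and only if P_{r+ε}(x) < P_{g+ε}(x).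 -/
open MeasureTheory

/-- The density of a centered Gaussian on `ℝ^d` with covariance `σ²I`:
`Pε(x) = (2πσ²)^{−d/2}·exp(−‖x‖²/(2σ²))`. -/
noncomputable def gaussianPdf (d : ℕ) (σ : ℝ) (x : EuclideanSpace ℝ (Fin d)) : ℝ :=
  (2 * Real.pi * σ ^ 2) ^ (-(d : ℝ) / 2) * Real.exp (-‖x‖ ^ 2 / (2 * σ ^ 2))

section GaussianSmoothing

variable {d : ℕ}

lemma gaussianPdf_pos {σ : ℝ} (hσ : 0 < σ) (x : EuclideanSpace ℝ (Fin d)) :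
    0 < gaussianPdf d σ x := by
  unfold gaussianPdf
  positivity

@[fun_prop]
lemma continuous_gaussianPdf (σ : ℝ) : Continuous (gaussianPdf d σ) := by
  unfold gaussianPdf
  fun_prop

lemma gaussianPdf_le (σ : ℝ) (x : EuclideanSpace ℝ (Fin d)) :
    gaussianPdf d σ x ≤ (2 * Real.pi * σ ^ 2) ^ (-(d : ℝ) / 2) := by
  unfold gaussianPdf
  refine mul_le_of_le_one_right (by positivity) (Real.exp_le_one_iff.2 ?_)
  exact div_nonpos_of_nonpos_of_nonneg (by simp) (by positivity)

lemma norm_gaussianPdf_smul_le {σ : ℝ} (hσ : 0 < σ) (x : EuclideanSpace ℝ (Fin d)) :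
    ‖gaussianPdf d σ x • x‖ ≤ (2 * Real.pi * σ ^ 2) ^ (-(d : ℝ) / 2) * σ := by
  rw [norm_smul, Real.norm_of_nonneg (gaussianPdf_pos hσ x).le, gaussianPdf, mul_assoc]
  refine mul_le_mul_of_nonneg_left ?_ (by positivity)
  rw [neg_div, Real.exp_neg, inv_mul_le_iff₀ (Real.exp_pos _)]
  have h := Real.add_one_le_exp (‖x‖ ^ 2 / (2 * σ ^ 2))
  have h' : ‖x‖ / σ ≤ ‖x‖ ^ 2 / (2 * σ ^ 2) + 1 := by
    have : ‖x‖ ^ 2 / (2 * σ ^ 2) = (‖x‖ / σ) ^ 2 / 2 := by field_simp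
    nlinarith [sq_nonneg (‖x‖ / σ - 1)]
  exact (div_le_iff₀ hσ).1 (h'.trans h)

lemma hasGradientAt_gaussianPdf {σ : ℝ} (hσ : σ ≠ 0) (x : EuclideanSpace ℝ (Fin d)) :
    HasGradientAt (gaussianPdf d σ) (-(1 / σ ^ 2) • gaussianPdf d σ x • x) x := by
  rw [hasGradientAt_iff_hasFDerivAt]
  have h := (((hasStrictFDerivAt_norm_sq x).hasFDerivAt.neg.mul_const
    (2 * σ ^ 2)⁻¹).exp).const_mul ((2 * Real.pi * σ ^ 2) ^ (-(d : ℝ) / 2))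
  refine h.congr_fderiv ?_
  ext v
  simp [gaussianPdf, div_eq_mul_inv]
  field_simp

lemma integrable_gaussianPdf_sub (μ : Measure (EuclideanSpace ℝ (Fin d))) [IsFiniteMeasure μ]
    {σ : ℝ} (hσ : 0 < σ) (x : EuclideanSpace ℝ (Fin d)) :
    Integrable (fun y => gaussianPdf d σ (x - y)) μ := by
  refine Integrable.of_bound (Continuous.aestronglyMeasurable (by fun_prop))
    ((2 * Real.pi * σ ^ 2) ^ (-(d : ℝ) / 2)) (Filter.Eventually.of_forall fun y => ?_)
  rw [Real.norm_of_nonneg (gaussianPdf_pos hσ _).le]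
  exact gaussianPdf_le σ _

lemma integrable_gaussianPdf_sub_smul (μ : Measure (EuclideanSpace ℝ (Fin d)))
    [IsFiniteMeasure μ] {σ : ℝ} (hσ : 0 < σ) (x : EuclideanSpace ℝ (Fin d)) :
    Integrable (fun y => gaussianPdf d σ (x - y) • (x - y)) μ :=
  Integrable.of_bound (Continuous.aestronglyMeasurable (by fun_prop)) _
    (Filter.Eventually.of_forall fun y => norm_gaussianPdf_smul_le hσ (x - y))

lemma integral_gaussianPdf_sub_pos (μ : Measure (EuclideanSpace ℝ (Fin d)))
    [IsFiniteMeasure μ] [NeZero μ] {σ : ℝ} (hσ : 0 < σ) (x : EuclideanSpace ℝ (Fin d)) :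
    0 < ∫ y, gaussianPdf d σ (x - y) ∂μ :=
  (integral_pos_iff_support_of_nonneg (fun y => (gaussianPdf_pos hσ (x - y)).le)
    (integrable_gaussianPdf_sub μ hσ x)).2 (by
      simp [Function.support, (gaussianPdf_pos hσ _).ne', NeZero.pos])

/-- Differentiation under the integral sign for the Gaussian smoothing of a finite measure. -/
lemma hasGradientAt_integral_gaussianPdf_sub (μ : Measure (EuclideanSpace ℝ (Fin d)))
    [IsFiniteMeasure μ] {σ : ℝ} (hσ : 0 < σ) (x : EuclideanSpace ℝ (Fin d)) :
    HasGradientAt (fun x' => ∫ y, gaussianPdf d σ (x' - y) ∂μ)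
      (-(1 / (2 * σ ^ 2)) • ∫ y, gaussianPdf d σ (x - y) • ((2 : ℝ) • (x - y)) ∂μ) x := by
  rw [hasGradientAt_iff_hasFDerivAt]
  have hI : Integrable (fun y => -(1 / σ ^ 2) • gaussianPdf d σ (x - y) • (x - y)) μ :=
    (integrable_gaussianPdf_sub_smul μ hσ x).smul (-(1 / σ ^ 2))
  have h := hasFDerivAt_integral_of_dominated_of_fderiv_le (μ := μ) (𝕜 := ℝ) (x₀ := x)
    (F := fun x' y => gaussianPdf d σ (x' - y))
    (F' := fun x' y => innerSL ℝ (-(1 / σ ^ 2) • gaussianPdf d σ (x' - y) • (x' - y)))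
    (bound := fun _ => 1 / σ ^ 2 * ((2 * Real.pi * σ ^ 2) ^ (-(d : ℝ) / 2) * σ))
    Filter.univ_mem
    (Filter.Eventually.of_forall fun x' => (integrable_gaussianPdf_sub μ hσ x').1)
    (integrable_gaussianPdf_sub μ hσ x)
    (Continuous.aestronglyMeasurable (by fun_prop))
    (Filter.Eventually.of_forall fun y x' _ => by
      rw [innerSL_apply_norm, norm_smul, norm_neg, Real.norm_of_nonneg (by positivity)]
      exact mul_le_mul_of_nonneg_left (norm_gaussianPdf_smul_le hσ _) (by positivity))
    (integrable_const _)
    (Filter.Eventually.of_forall fun y x' _ =>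
      (hasFDerivAt_comp_sub y).2 (hasGradientAt_gaussianPdf hσ.ne' (x' - y)).hasFDerivAt)
  refine h.congr_fderiv ?_
  rw [ContinuousLinearMap.integral_comp_comm (innerSL ℝ) hI, integral_smul]
  simp_rw [smul_comm _ (2 : ℝ)]
  rw [integral_smul, smul_smul]
  have : -(1 / (2 * σ ^ 2)) * 2 = -(1 / σ ^ 2) := by field_simp
  rw [this]
  rfl

end GaussianSmoothing

/-- **The gradient passed to the generator under Gaussian noise.**
Let `P_r`, `P_g` be probability measures supported in `M`, `P` respectively, let
`P_{r+ε}`, `P_{g+ε}` be their Gaussian smoothings, and let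
`D*(x) = P_{r+ε}(x)/(P_{r+ε}(x) + P_{g+ε}(x))`, `a(x) = (1/(2σ²))/(P_{g+ε}(x) + P_{r+ε}(x))`,
`b(x) = a(x)·P_{r+ε}(x)/P_{g+ε}(x)`. Then for every `x`:
`∇_x log(1 − D*(x)) = a(x)∫_M Pε(x−y)∇_x‖x−y‖² dP_r(y) − b(x)∫_P Pε(x−y)∇_x‖x−y‖² dP_g(y)`
(with `∇_x‖x−y‖² = 2(x−y)`), and `a(x) > 0`, `b(x) > 0`, with `b(x) > a(x)` iff
`P_{r+ε}(x) > P_{g+ε}(x)` and `b(x) < a(x)` iff `P_{r+ε}(x) < P_{g+ε}(x)`. -/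
theorem generator_gradient_with_gaussian_noise {d : ℕ}
    (Pr Pg : Measure (EuclideanSpace ℝ (Fin d)))
    [IsProbabilityMeasure Pr] [IsProbabilityMeasure Pg]
    (M P : Set (EuclideanSpace ℝ (Fin d)))
    (hM : MeasurableSet M) (hP : MeasurableSet P)
    (hrM : Pr M = 1) (hgP : Pg P = 1)
    (σ : ℝ) (hσ : 0 < σ)
    (Pre Pge : EuclideanSpace ℝ (Fin d) → ℝ)
    (hPre : ∀ x, Pre x = ∫ y, gaussianPdf d σ (x - y) ∂Pr)
    (hPge : ∀ x, Pge x = ∫ y, gaussianPdf d σ (x - y) ∂Pg)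
    (Dstar : EuclideanSpace ℝ (Fin d) → ℝ)
    (hD : ∀ x, Dstar x = Pre x / (Pre x + Pge x))
    (a b : EuclideanSpace ℝ (Fin d) → ℝ)
    (ha : ∀ x, a x = (1 / (2 * σ ^ 2)) * (1 / (Pge x + Pre x)))
    (hb : ∀ x, b x = a x * (Pre x / Pge x)) :
    ∀ x : EuclideanSpace ℝ (Fin d),
      HasGradientAt (fun x' => Real.log (1 - Dstar x'))
        (a x • (∫ y in M, gaussianPdf d σ (x - y) • ((2 : ℝ) • (x - y)) ∂Pr) -
          b x • ∫ y in P, gaussianPdf d σ (x - y) • ((2 : ℝ) • (x - y)) ∂Pg) x ∧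
      0 < a x ∧ 0 < b x ∧
      (a x < b x ↔ Pge x < Pre x) ∧
      (b x < a x ↔ Pre x < Pge x) := by
  intro x
  have hr (x) : 0 < Pre x := hPre x ▸ integral_gaussianPdf_sub_pos Pr hσ x
  have hg (x) : 0 < Pge x := hPge x ▸ integral_gaussianPdf_sub_pos Pg hσ x
  have hax : 0 < a x := by
    have := hr x
    have := hg x
    rw [ha]
    positivity
  have hgr : HasFDerivAt Pre _ x :=
    funext hPre ▸ (hasGradientAt_integral_gaussianPdf_sub Pr hσ x).hasFDerivAt
  have hgg : HasFDerivAt Pge _ x :=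
    funext hPge ▸ (hasGradientAt_integral_gaussianPdf_sub Pg hσ x).hasFDerivAt
  have hrx := hr x
  have hgx := hg x
  refine ⟨?_, hax, ?_, ?_, ?_⟩
  · rw [Measure.restrict_eq_self_of_ae_mem ((mem_ae_iff_prob_eq_one hM).2 hrM),
      Measure.restrict_eq_self_of_ae_mem ((mem_ae_iff_prob_eq_one hP).2 hgP),
      hasGradientAt_iff_hasFDerivAt]
    have hlog : (fun x' => Real.log (1 - Dstar x')) =
        fun x' => Real.log (Pge x') - Real.log (Pre x' + Pge x') := by
      ext x'
      have h1 := hr x'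
      have h2 := hg x'
      rw [← Real.log_div h2.ne' (by positivity), hD]
      congr 1
      field_simp
      ring
    rw [hlog]
    refine ((hgg.log hgx.ne').sub ((hgr.add hgg).log (add_pos hrx hgx).ne')).congr_fderiv ?_
    simp only [map_sub, map_smul, Pi.add_apply]
    rw [hb, ha]
    match_scalars <;> field_simp <;> ring
  · rw [hb]
    positivity
  · rw [hb, lt_mul_iff_one_lt_right hax, one_lt_div hgx]
  · rw [hb, mul_lt_iff_lt_one_right hax, div_lt_one hgx]
end

section
/- Let P_r and P_g be any two probability measures on ℝ^d, and let ε be an independent random vector with mean 0 and V = E[‖ε‖₂²] < ∞. Write P_{r+ε} and P_{g+ε} for the laws of x + ε with x ∼ P_r and x ∼ P_g respectively, and suppose P_{r+ε} and P_{g+ε} have supports contained in a ball of diameter C. Then there exists a coupling γ of P_r and P_g with ∫ ‖x − y‖₂ dγ(x, y) ≤ 2·V^{1/2} + 2·C·√(JSD(P_{r+ε} ‖ P_{g+ε})); consequently W(P_r, P_g) ≤ 2·V^{1/2} + 2·C·√(JSD(P_{r+ε} ‖ P_{g+ε})). -/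
open MeasureTheory
open scoped ENNReal

open scoped Classical in
/-- The Kullback–Leibler divergence of `μ` from `ν`, equal to `+∞` when `μ` is not
absolutely continuous with respect to `ν` (or the log-likelihood ratio is not integrable). -/
noncomputable def KLdiv {α : Type*} [MeasurableSpace α] (μ ν : Measure α) : ℝ≥0∞ :=
  if μ ≪ ν ∧ Integrable (llr μ ν) μ then ENNReal.ofReal (∫ x, llr μ ν x ∂μ) else ⊤

/-- The Jensen–Shannon divergence `JSD(P‖Q) = ½KL(P‖m) + ½KL(Q‖m)` with `m = ½(P+Q)`. -/
noncomputable def JSdiv {α : Type*} [MeasurableSpace α] (μ ν : Measure α) : ℝ≥0∞ :=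
  2⁻¹ * KLdiv μ ((2 : ℝ≥0∞)⁻¹ • (μ + ν)) + 2⁻¹ * KLdiv ν ((2 : ℝ≥0∞)⁻¹ • (μ + ν))

/-- The Wasserstein-1 distance: infimum over couplings `γ` of `P` and `Q` of
`∫ ‖x − y‖ dγ(x,y)`. -/
noncomputable def wasserstein1 {d : ℕ}
    (P Q : Measure (EuclideanSpace ℝ (Fin d))) : ℝ≥0∞ :=
  ⨅ (γ : Measure (EuclideanSpace ℝ (Fin d) × EuclideanSpace ℝ (Fin d)))
    (_ : γ.map Prod.fst = P ∧ γ.map Prod.snd = Q),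
      ∫⁻ q, ENNReal.ofReal ‖q.1 - q.2‖ ∂γ

/-- The law of `x + ε` where `x ∼ P` and `ε ∼ ν` independently (the convolution `P ∗ ν`). -/
noncomputable def addNoise {d : ℕ}
    (P ν : Measure (EuclideanSpace ℝ (Fin d))) : Measure (EuclideanSpace ℝ (Fin d)) :=
  (P.prod ν).map fun q => q.1 + q.2

open ProbabilityTheory

lemma sq_sub_div_eight_le_mul_log_add_mul_log {x y : ℝ} (hx : 0 ≤ x) (hy : 0 ≤ y)
    (hxy : x + y = 2) :
    (x - y) ^ 2 / 8 ≤ x * Real.log x + y * Real.log y := by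
  have key : ∀ z : ℝ, 0 ≤ z → 2 * z - 2 * √z ≤ z * Real.log z := by
    intro z hz
    rcases hz.eq_or_lt with rfl | hz
    · simp
    have hs : 0 < √z := Real.sqrt_pos.2 hz
    have h1 := Real.one_sub_inv_le_log_of_pos hs
    rw [Real.log_sqrt hz.le] at h1
    have h2 : z * (√z)⁻¹ = √z := by
      rw [← div_eq_mul_inv, Real.div_sqrt]
    nlinarith [mul_le_mul_of_nonneg_left h1 hz.le]
  have hsx := Real.sq_sqrt hx
  have hsy := Real.sq_sqrt hy
  have hx' := Real.sqrt_nonneg x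
  have hy' := Real.sqrt_nonneg y
  have h1 := key x hx
  have h2 := key y hy
  set a := √x
  set b := √y
  have hab : a * b ≤ 1 - (x - y) ^ 2 / 8 := by
    refine abs_le_of_sq_le_sq' ?_ ?_ |>.2
    · have : (a * b) ^ 2 = x * y := by rw [mul_pow, hsx, hsy]
      rw [this]
      have hy2 : y = 2 - x := by linarith
      subst hy2
      nlinarith [sq_nonneg ((x - (2 - x)) ^ 2)]
    · have hy2 : y = 2 - x := by linarith
      subst hy2
      nlinarith
  have hs : a + b ≤ 2 - (x - y) ^ 2 / 16 := by
    refine abs_le_of_sq_le_sq' ?_ ?_ |>.2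
    · nlinarith [sq_nonneg ((x - y) ^ 2)]
    · have hy2 : y = 2 - x := by linarith
      subst hy2
      nlinarith
  linarith

lemma integral_norm_le_sqrt_integral_norm_sq {α E : Type*} [MeasurableSpace α]
    [NormedAddCommGroup E] {μ : Measure α} [IsProbabilityMeasure μ] {f : α → E}
    (hf : MemLp f 2 μ) : ∫ x, ‖f x‖ ∂μ ≤ √(∫ x, ‖f x‖ ^ 2 ∂μ) := by
  have h := ProbabilityTheory.variance_nonneg (fun x => ‖f x‖) μ
  rw [ProbabilityTheory.variance_eq_sub hf.norm] at h
  refine Real.le_sqrt_of_sq_le ?_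
  simpa using h

/-- Two probability measures share a common part whose complement has mass at most
`2 √JSD`. -/
lemma exists_common_part {α : Type*} [MeasurableSpace α] (P Q : Measure α)
    [IsProbabilityMeasure P] [IsProbabilityMeasure Q] :
    ∃ μ P' Q' : Measure α, P = μ + P' ∧ Q = μ + Q' ∧
      P' Set.univ = Q' Set.univ ∧
      P' Set.univ ≤ ENNReal.ofReal (2 * √(JSdiv P Q).toReal) := by
  set m : Measure α := (2 : ℝ≥0∞)⁻¹ • (P + Q) with hm
  have hm1 : IsProbabilityMeasure m := by
    constructor
    simp [hm, ENNReal.inv_two_add_inv_two]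
  have h2m : P + Q = (2 : ℝ≥0∞) • m := by
    rw [hm, smul_smul, ENNReal.mul_inv_cancel (by simp) (by simp), one_smul]
  have hPm : P ≪ m := by
    refine Measure.AbsolutelyContinuous.trans ?_ (Measure.absolutelyContinuous_smul (by simp))
    exact (Measure.le_add_right le_rfl).absolutelyContinuous
  have hQm : Q ≪ m := by
    refine Measure.AbsolutelyContinuous.trans ?_ (Measure.absolutelyContinuous_smul (by simp))
    exact (Measure.le_add_left le_rfl).absolutelyContinuous
  set p := P.rnDeriv m with hp
  set q := Q.rnDeriv m with hq
  have mp : Measurable p := Measure.measurable_rnDeriv _ _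
  have mq : Measurable q := Measure.measurable_rnDeriv _ _
  have hPp : m.withDensity p = P := Measure.withDensity_rnDeriv_eq P m hPm
  have hQq : m.withDensity q = Q := Measure.withDensity_rnDeriv_eq Q m hQm
  have hsum : ∀ᵐ x ∂m, p x + q x = 2 := by
    have : m.withDensity (p + q) = m.withDensity (fun _ => 2) := by
      rw [withDensity_add_left mp, hPp, hQq, h2m, withDensity_const]
    exact (withDensity_eq_iff (mp.add mq).aemeasurable aemeasurable_const
      (by
        simp only [Pi.add_apply]
        rw [lintegral_add_left mp]
        simp [hp, hq, Measure.lintegral_rnDeriv hPm, Measure.lintegral_rnDeriv hQm])).1 this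
  have hptop : ∀ᵐ x ∂m, p x ≠ ∞ ∧ q x ≠ ∞ := by
    filter_upwards [hsum] with x hx
    constructor <;> intro h <;> simp [h] at hx
  have hsumR : ∀ᵐ x ∂m, (p x).toReal + (q x).toReal = 2 := by
    filter_upwards [hsum, hptop] with x hx hx'
    rw [← ENNReal.toReal_add hx'.1 hx'.2, hx]; simp
  have hint : ∀ r : α → ℝ≥0∞, Measurable r → (∀ᵐ x ∂m, (r x).toReal ≤ 2) →
      Integrable (fun x => (r x).toReal * Real.log (r x).toReal) m := by
    intro r hr hr2
    have hc : IsCompact ((fun z : ℝ => z * Real.log z) '' Set.Icc 0 2) :=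
      isCompact_Icc.image Real.continuous_mul_log
    obtain ⟨K, hK⟩ := hc.isBounded.exists_norm_le
    refine Integrable.of_bound
      (Real.continuous_mul_log.measurable.comp hr.ennreal_toReal).aestronglyMeasurable K ?_
    filter_upwards [hr2] with x hx
    exact hK _ ⟨_, ⟨ENNReal.toReal_nonneg, hx⟩, rfl⟩
  have hip := hint p mp (by
    filter_upwards [hsumR] with x hx
    linarith [(ENNReal.toReal_nonneg : 0 ≤ (q x).toReal)])
  have hiq := hint q mq (by
    filter_upwards [hsumR] with x hx
    linarith [(ENNReal.toReal_nonneg : 0 ≤ (p x).toReal)])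
  have hJ : (∫ x, (p x).toReal * Real.log (p x).toReal + (q x).toReal * Real.log (q x).toReal ∂m)
      ≤ 2 * (JSdiv P Q).toReal := by
    rw [integral_add hip hiq, hp, hq, integral_rnDeriv_mul_log hPm, integral_rnDeriv_mul_log hQm]
    rw [JSdiv, KLdiv, KLdiv, ← hm, if_pos ⟨hPm, (integrable_rnDeriv_mul_log_iff hPm).1 hip⟩,
      if_pos ⟨hQm, (integrable_rnDeriv_mul_log_iff hQm).1 hiq⟩,
      ENNReal.toReal_add (by finiteness) (by finiteness)]
    simp only [ENNReal.toReal_mul, ENNReal.toReal_inv, ENNReal.toReal_ofNat,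
      ENNReal.toReal_ofReal']
    linarith [le_max_left (∫ x, llr P m x ∂m) 0, le_max_left (∫ x, llr P m x ∂P) 0,
      le_max_left (∫ x, llr Q m x ∂Q) 0]
  set D : α → ℝ := fun x => (p x).toReal - (q x).toReal with hD
  have hDbd : ∀ᵐ x ∂m, ‖D x‖ ≤ 2 := by
    filter_upwards [hsumR] with x hx
    have h1 : 0 ≤ (p x).toReal := ENNReal.toReal_nonneg
    have h2 : 0 ≤ (q x).toReal := ENNReal.toReal_nonneg
    rw [Real.norm_eq_abs, abs_le]
    constructor <;> simp only [hD] <;> linarith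
  have hDL : MemLp D 2 m :=
    MemLp.of_bound (mp.ennreal_toReal.sub mq.ennreal_toReal).aestronglyMeasurable 2 hDbd
  have hD2 : ∫ x, D x ^ 2 ∂m ≤ 16 * (JSdiv P Q).toReal := by
    have : ∫ x, D x ^ 2 / 8 ∂m ≤ ∫ x, (p x).toReal * Real.log (p x).toReal
        + (q x).toReal * Real.log (q x).toReal ∂m := by
      refine integral_mono_ae (hDL.integrable_sq.div_const 8) (hip.add hiq) ?_
      filter_upwards [hsumR] with x hx
      exact sq_sub_div_eight_le_mul_log_add_mul_log ENNReal.toReal_nonneg ENNReal.toReal_nonneg hx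
    rw [integral_div] at this
    linarith
  have hD1 : ∫ x, ‖D x‖ ∂m ≤ 4 * √(JSdiv P Q).toReal := by
    have h := integral_norm_le_sqrt_integral_norm_sq hDL
    simp only [Real.norm_eq_abs, sq_abs] at h ⊢
    refine h.trans ?_
    calc √(∫ x, D x ^ 2 ∂m) ≤ √(4 ^ 2 * (JSdiv P Q).toReal) := by
          apply Real.sqrt_le_sqrt; linarith
      _ = 4 * √(JSdiv P Q).toReal := by
          rw [Real.sqrt_mul (by positivity), Real.sqrt_sq (by positivity)]
  have hmin : Measurable fun x => min (p x) (q x) := mp.min mq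
  have hP : P = m.withDensity (fun x => min (p x) (q x)) +
      m.withDensity (fun x => p x - q x) := by
    rw [← withDensity_add_left hmin, ← hPp]
    congr 1
    ext x
    rcases le_total (p x) (q x) with h | h <;> simp [h, tsub_eq_zero_of_le h, add_tsub_cancel_of_le h]
  have hQ : Q = m.withDensity (fun x => min (p x) (q x)) +
      m.withDensity (fun x => q x - p x) := by
    rw [← withDensity_add_left hmin, ← hQq]
    congr 1
    ext x
    rcases le_total (p x) (q x) with h | h <;> simp [h, tsub_eq_zero_of_le h, add_tsub_cancel_of_le h]
  refine ⟨_, _, _, hP, hQ, ?_⟩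
  have hPu := congrArg (fun μ => μ Set.univ) hP
  have hQu := congrArg (fun μ => μ Set.univ) hQ
  simp only [measure_univ, Measure.add_apply] at hPu hQu
  have heq : m.withDensity (fun x => p x - q x) Set.univ
      = m.withDensity (fun x => q x - p x) Set.univ := by
    refine (ENNReal.add_right_inj (a := m.withDensity (fun x => min (p x) (q x)) Set.univ) ?_).1
      (hPu.symm.trans hQu)
    intro h
    simp [h] at hPu
  refine ⟨heq, ?_⟩
  have htwo : 2 * m.withDensity (fun x => p x - q x) Set.univ
      = ENNReal.ofReal (∫ x, ‖D x‖ ∂m) := by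
    rw [two_mul]
    nth_rw 2 [heq]
    rw [withDensity_apply _ .univ, withDensity_apply _ .univ, setLIntegral_univ,
      setLIntegral_univ, ← lintegral_add_left (show Measurable fun x => p x - q x from mp.sub mq),
      ofReal_integral_norm_eq_lintegral_enorm (hDL.integrable (by norm_num))]
    refine lintegral_congr_ae ?_
    filter_upwards [hptop] with x hx
    have hpx := ENNReal.ofReal_toReal hx.1
    have hqx := ENNReal.ofReal_toReal hx.2
    have h1 : 0 ≤ (p x).toReal := ENNReal.toReal_nonneg
    have h2 : 0 ≤ (q x).toReal := ENNReal.toReal_nonneg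
    rw [← ofReal_norm, Real.norm_eq_abs]
    rcases le_total (p x) (q x) with h | h
    · have h' := ENNReal.toReal_mono hx.2 h
      rw [tsub_eq_zero_of_le h, zero_add, abs_of_nonpos (sub_nonpos.2 h'), neg_sub,
        ENNReal.ofReal_sub _ h1, hpx, hqx]
    · have h' := ENNReal.toReal_mono hx.1 h
      rw [tsub_eq_zero_of_le h, add_zero, abs_of_nonneg (sub_nonneg.2 h'),
        ENNReal.ofReal_sub _ h2, hpx, hqx]
  have h4 : ENNReal.ofReal (4 * √(JSdiv P Q).toReal)
      = 2 * ENNReal.ofReal (2 * √(JSdiv P Q).toReal) := by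
    rw [← ENNReal.ofReal_ofNat 2, ← ENNReal.ofReal_mul (by norm_num)]
    congr 1; ring
  refine (ENNReal.mul_le_mul_iff_right (a := 2) (by simp) (by simp)).1 ?_
  rw [htwo, ← h4]
  exact ENNReal.ofReal_le_ofReal hD1

/-- A coupling that leaves the common part fixed and moves the rest inside `B`. -/
lemma exists_coupling_of_common_part {X : Type*} [MeasurableSpace X] [PseudoEMetricSpace X]
    [OpensMeasurableSpace X] [SecondCountableTopology X]
    {μ P' Q' : Measure X} [IsFiniteMeasure P'] [IsFiniteMeasure Q']
    (hPQ : P' Set.univ = Q' Set.univ) {B : Set X}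
    (hP : ∀ᵐ x ∂P', x ∈ B) (hQ : ∀ᵐ x ∂Q', x ∈ B) :
    ∃ π : Measure (X × X), π.map Prod.fst = μ + P' ∧ π.map Prod.snd = μ + Q' ∧
      ∫⁻ z, edist z.1 z.2 ∂π ≤ Metric.ediam B * P' Set.univ := by
  have hd : Measurable fun x : X => (x, x) := by fun_prop
  have hscale : ∀ ρ : Measure X, ρ Set.univ = P' Set.univ →
      (P' Set.univ)⁻¹ • P' Set.univ • ρ = ρ := by
    intro ρ h
    rcases eq_or_ne (P' Set.univ) 0 with h0 | h0
    · rw [h0, Measure.measure_univ_eq_zero] at h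
      simp [h]
    · rw [smul_smul, ENNReal.inv_mul_cancel h0 (measure_ne_top _ _), one_smul]
  refine ⟨μ.map (fun x => (x, x)) + (P' Set.univ)⁻¹ • P'.prod Q', ?_, ?_, ?_⟩
  · rw [Measure.map_add _ _ measurable_fst, Measure.map_map measurable_fst hd, Measure.map_smul,
      Measure.map_fst_prod, ← hPQ, hscale _ rfl]
    simp [Function.comp_def]
  · rw [Measure.map_add _ _ measurable_snd, Measure.map_map measurable_snd hd, Measure.map_smul,
      Measure.map_snd_prod, hscale _ hPQ.symm]
    simp [Function.comp_def]
  · rw [lintegral_add_measure, lintegral_map measurable_edist hd, lintegral_smul_measure]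
    simp only [edist_self, lintegral_zero, zero_add]
    have h1 : ∫⁻ z, edist z.1 z.2 ∂(P'.prod Q') ≤ ∫⁻ _, Metric.ediam B ∂(P'.prod Q') := by
      refine lintegral_mono_ae ?_
      filter_upwards [Measure.quasiMeasurePreserving_fst.ae hP,
        Measure.quasiMeasurePreserving_snd.ae hQ] with z h1 h2
      exact Metric.edist_le_ediam_of_mem h1 h2
    rw [lintegral_const, ← Set.univ_prod_univ, Measure.prod_prod, ← hPQ] at h1
    rw [smul_eq_mul]
    calc (P' Set.univ)⁻¹ * ∫⁻ z, edist z.1 z.2 ∂(P'.prod Q')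
        ≤ (P' Set.univ)⁻¹ * (Metric.ediam B * (P' Set.univ * P' Set.univ)) := by gcongr
      _ = (P' Set.univ)⁻¹ * P' Set.univ * (Metric.ediam B * P' Set.univ) := by ring
      _ ≤ 1 * (Metric.ediam B * P' Set.univ) := by
          gcongr; exact ENNReal.inv_mul_le_one _
      _ = _ := one_mul _

/-- Gluing along conditional kernels: a coupling of the first marginals of `ρ₁` and `ρ₂` induces
a coupling of their second marginals, with the triangle inequality for the costs. -/
lemma exists_coupling_snd_of_coupling_fst {X : Type*} [MeasurableSpace X] [PseudoEMetricSpace X]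
    [BorelSpace X] [StandardBorelSpace X] [Nonempty X] [SecondCountableTopology X]
    (ρ₁ ρ₂ π : Measure (X × X)) [IsFiniteMeasure ρ₁] [IsFiniteMeasure ρ₂] [IsFiniteMeasure π]
    (h₁ : π.map Prod.fst = ρ₁.fst) (h₂ : π.map Prod.snd = ρ₂.fst) :
    ∃ γ : Measure (X × X), γ.map Prod.fst = ρ₁.snd ∧ γ.map Prod.snd = ρ₂.snd ∧
      ∫⁻ z, edist z.1 z.2 ∂γ ≤
        ∫⁻ z, edist z.1 z.2 ∂ρ₁ + ∫⁻ z, edist z.1 z.2 ∂π + ∫⁻ z, edist z.1 z.2 ∂ρ₂ := by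
  set κ : Kernel (X × X) (X × X) :=
    (ρ₁.condKernel.comap Prod.fst measurable_fst) ×ₖ
      (ρ₂.condKernel.comap Prod.snd measurable_snd)
  have hd : Measurable fun z : X × X => edist z.1 z.2 := measurable_edist
  have key : ∀ ρ : Measure (X × X), ∀ _ : IsFiniteMeasure ρ,
      ∀ f : X × X → ℝ≥0∞, Measurable f →
        ∫⁻ z, f z ∂ρ = ∫⁻ x, ∫⁻ y, f (x, y) ∂ρ.condKernel x ∂ρ.fst := by
    intro ρ _ f hf
    conv_lhs => rw [← ρ.disintegrate ρ.condKernel]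
    exact Measure.lintegral_compProd hf
  have bind_cond : ∀ ρ : Measure (X × X), ∀ _ : IsFiniteMeasure ρ,
      ρ.condKernel ∘ₘ ρ.fst = ρ.snd := by
    intro ρ _
    rw [← Measure.snd_compProd, ρ.disintegrate ρ.condKernel]
  refine ⟨κ ∘ₘ π, ?_, ?_, ?_⟩
  · rw [Measure.map_comp _ _ measurable_fst, ← Kernel.fst_eq, Kernel.fst_prod]
    ext s hs
    rw [Measure.bind_apply hs (Kernel.aemeasurable _), ← bind_cond ρ₁ inferInstance,
      Measure.bind_apply hs (Kernel.aemeasurable _), ← h₁,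
      lintegral_map (Kernel.measurable_coe _ hs) measurable_fst]
    rfl
  · rw [Measure.map_comp _ _ measurable_snd, ← Kernel.snd_eq, Kernel.snd_prod]
    ext s hs
    rw [Measure.bind_apply hs (Kernel.aemeasurable _), ← bind_cond ρ₂ inferInstance,
      Measure.bind_apply hs (Kernel.aemeasurable _), ← h₂,
      lintegral_map (Kernel.measurable_coe _ hs) measurable_snd]
    rfl
  · rw [Measure.lintegral_bind κ.aemeasurable hd.aemeasurable]
    have h3 : ∀ z : X × X, ∫⁻ w, edist w.1 w.2 ∂(κ z) ≤
        ∫⁻ x, edist z.1 x ∂(ρ₁.condKernel z.1) + edist z.1 z.2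
          + ∫⁻ y, edist z.2 y ∂(ρ₂.condKernel z.2) := by
      intro z
      have mx : ∀ a : X, Measurable fun x => edist a x :=
        fun a => measurable_const.edist measurable_id
      rw [Kernel.prod_apply, Kernel.comap_apply, Kernel.comap_apply]
      calc _ ≤ ∫⁻ w, (edist z.1 w.1 + edist z.1 z.2) + edist z.2 w.2
              ∂((ρ₁.condKernel z.1).prod (ρ₂.condKernel z.2)) := by
            refine lintegral_mono fun w => ?_
            refine (edist_triangle4 w.1 z.1 z.2 w.2).trans ?_
            rw [edist_comm w.1]
        _ = _ := by
            rw [lintegral_add_right _ (show Measurable fun w : X × X => edist z.2 w.2 from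
                (mx _).comp measurable_snd),
              lintegral_add_right _ measurable_const,
              ← lintegral_map (f := fun w => edist z.1 w) (mx _) measurable_fst,
              ← lintegral_map (f := fun w => edist z.2 w) (mx _) measurable_snd,
              Measure.map_fst_prod, Measure.map_snd_prod]
            simp
    have m1 : ∀ ρ : Measure (X × X), ∀ _ : IsFiniteMeasure ρ,
        Measurable fun x => ∫⁻ y, edist x y ∂(ρ.condKernel x) :=
      fun ρ _ => hd.lintegral_kernel_prod_right
    refine (lintegral_mono h3).trans_eq ?_
    rw [lintegral_add_right _ (show Measurable fun z : X × X =>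
        ∫⁻ y, edist z.2 y ∂(ρ₂.condKernel z.2) from (m1 ρ₂ inferInstance).comp measurable_snd),
      lintegral_add_right _ hd,
      ← lintegral_map (m1 ρ₁ inferInstance) measurable_fst,
      ← lintegral_map (m1 ρ₂ inferInstance) measurable_snd,
      h₁, h₂, key ρ₁ inferInstance _ hd, key ρ₂ inferInstance _ hd]

lemma lintegral_edist_noise_le {d : ℕ} (P ν : Measure (EuclideanSpace ℝ (Fin d)))
    [IsProbabilityMeasure P] [IsProbabilityMeasure ν]
    (hsq : Integrable (fun y : EuclideanSpace ℝ (Fin d) => ‖y‖ ^ 2) ν) :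
    ∫⁻ z, edist z.1 z.2 ∂((P.prod ν).map fun q => (q.1 + q.2, q.1)) ≤
      ENNReal.ofReal √(∫ y, ‖y‖ ^ 2 ∂ν) := by
  have hL : MemLp (fun y : EuclideanSpace ℝ (Fin d) => y) 2 ν :=
    (memLp_two_iff_integrable_sq_norm aestronglyMeasurable_id).2 hsq
  rw [lintegral_map measurable_edist (by fun_prop)]
  have h : ∀ q : EuclideanSpace ℝ (Fin d) × EuclideanSpace ℝ (Fin d),
      edist (q.1 + q.2) q.1 = ‖q.2‖ₑ := fun q => by
    rw [edist_eq_enorm_sub, add_sub_cancel_left]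
  simp only [h]
  rw [← lintegral_map (f := fun y : EuclideanSpace ℝ (Fin d) => ‖y‖ₑ) measurable_enorm
    measurable_snd, Measure.map_snd_prod, measure_univ, one_smul,
    ← ofReal_integral_norm_eq_lintegral_enorm (hL.integrable (by norm_num))]
  exact ENNReal.ofReal_le_ofReal (integral_norm_le_sqrt_integral_norm_sq hL)

/-- **Wasserstein bound via the Jensen–Shannon divergence of the noisy distributions.**
Let `P_r`, `P_g` be probability measures on `ℝ^d`, let `ε ∼ ν` be an independent noise
vector with mean `0` and `V = E[‖ε‖²] < ∞`, and suppose the noisy laws `P_{r+ε}`, `P_{g+ε}`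
have supports contained in a ball of diameter `C`. Then there is a coupling `γ` of `P_r`
and `P_g` with `∫ ‖x − y‖ dγ ≤ 2·V^{1/2} + 2·C·√(JSD(P_{r+ε}‖P_{g+ε}))`; consequently
`W(P_r, P_g) ≤ 2·V^{1/2} + 2·C·√(JSD(P_{r+ε}‖P_{g+ε}))`. -/
theorem wasserstein_le_noise_plus_jsd {d : ℕ}
    (Pr Pg ν : Measure (EuclideanSpace ℝ (Fin d)))
    [IsProbabilityMeasure Pr] [IsProbabilityMeasure Pg] [IsProbabilityMeasure ν]
    (hmean : ∫ y, y ∂ν = 0)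
    (hsq : Integrable (fun y : EuclideanSpace ℝ (Fin d) => ‖y‖ ^ 2) ν)
    (V : ℝ) (hV : V = ∫ y, ‖y‖ ^ 2 ∂ν)
    (C : ℝ) (c : EuclideanSpace ℝ (Fin d))
    (hrball : addNoise Pr ν (Metric.closedBall c (C / 2)) = 1)
    (hgball : addNoise Pg ν (Metric.closedBall c (C / 2)) = 1) :
    (∃ γ : Measure (EuclideanSpace ℝ (Fin d) × EuclideanSpace ℝ (Fin d)),
      γ.map Prod.fst = Pr ∧ γ.map Prod.snd = Pg ∧
      (∫⁻ q, ENNReal.ofReal ‖q.1 - q.2‖ ∂γ) ≤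
        ENNReal.ofReal (2 * Real.sqrt V +
          2 * C * Real.sqrt (JSdiv (addNoise Pr ν) (addNoise Pg ν)).toReal)) ∧
    wasserstein1 Pr Pg ≤
      ENNReal.ofReal (2 * Real.sqrt V +
        2 * C * Real.sqrt (JSdiv (addNoise Pr ν) (addNoise Pg ν)).toReal) := by
  have hC : 0 ≤ C := by
    by_contra! h
    rw [Metric.closedBall_eq_empty.2 (by linarith)] at hrball
    simp at hrball
  have hprob : ∀ P : Measure (EuclideanSpace ℝ (Fin d)), IsProbabilityMeasure P →
      IsProbabilityMeasure (addNoise P ν) := fun P _ =>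
    Measure.isProbabilityMeasure_map (by fun_prop)
  have := hprob Pr inferInstance
  have := hprob Pg inferInstance
  set B := Metric.closedBall c (C / 2)
  have hB : MeasurableSet B := measurableSet_closedBall
  have hdiam : Metric.ediam B ≤ ENNReal.ofReal C := by
    refine Metric.ediam_le fun x hx y hy => ?_
    rw [edist_dist]
    refine ENNReal.ofReal_le_ofReal ?_
    linarith [dist_triangle_right x y c, Metric.mem_closedBall.1 hx, Metric.mem_closedBall.1 hy]
  obtain ⟨μ, P', Q', hP, hQ, hPQ, hmass⟩ := exists_common_part (addNoise Pr ν) (addNoise Pg ν)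
  have hP'le : P' ≤ addNoise Pr ν := hP ▸ Measure.le_add_left le_rfl
  have hQ'le : Q' ≤ addNoise Pg ν := hQ ▸ Measure.le_add_left le_rfl
  have := isFiniteMeasure_of_le _ hP'le
  have := isFiniteMeasure_of_le _ hQ'le
  obtain ⟨π, hπ1, hπ2, hπ⟩ := exists_coupling_of_common_part (μ := μ) hPQ (B := B)
    (ae_mono hP'le ((mem_ae_iff_prob_eq_one hB).2 hrball))
    (ae_mono hQ'le ((mem_ae_iff_prob_eq_one hB).2 hgball))
  rw [← hP] at hπ1
  rw [← hQ] at hπ2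
  have : IsProbabilityMeasure π := by
    constructor
    rw [← Set.preimage_univ (f := Prod.fst), ← Measure.map_apply measurable_fst .univ, hπ1,
      measure_univ]
  have hmeas : Measurable fun q : EuclideanSpace ℝ (Fin d) × EuclideanSpace ℝ (Fin d) =>
      (q.1 + q.2, q.1) := by fun_prop
  have hfst : ∀ P : Measure (EuclideanSpace ℝ (Fin d)),
      ((P.prod ν).map fun q => (q.1 + q.2, q.1)).fst = addNoise P ν := fun P => by
    rw [Measure.fst, Measure.map_map measurable_fst hmeas]; rfl
  have hsnd : ∀ P : Measure (EuclideanSpace ℝ (Fin d)),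
      ((P.prod ν).map fun q => (q.1 + q.2, q.1)).snd = P := fun P => by
    rw [Measure.snd, Measure.map_map measurable_snd hmeas]
    exact (Measure.map_fst_prod).trans (by simp)
  obtain ⟨γ, hγ1, hγ2, hγ⟩ := exists_coupling_snd_of_coupling_fst
    ((Pr.prod ν).map fun q => (q.1 + q.2, q.1)) ((Pg.prod ν).map fun q => (q.1 + q.2, q.1)) π
    (by rw [hfst, hπ1]) (by rw [hfst, hπ2])
  rw [hsnd] at hγ1 hγ2
  have hcost : (∫⁻ q, ENNReal.ofReal ‖q.1 - q.2‖ ∂γ) ≤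
      ENNReal.ofReal (2 * Real.sqrt V +
        2 * C * Real.sqrt (JSdiv (addNoise Pr ν) (addNoise Pg ν)).toReal) := by
    simp only [← dist_eq_norm, ← edist_dist]
    refine hγ.trans ?_
    calc _ ≤ ENNReal.ofReal √V + ENNReal.ofReal C *
          ENNReal.ofReal (2 * √(JSdiv (addNoise Pr ν) (addNoise Pg ν)).toReal)
          + ENNReal.ofReal √V := by
          rw [hV]
          gcongr
          · exact lintegral_edist_noise_le Pr ν hsq
          · exact hπ.trans (by gcongr)
          · exact lintegral_edist_noise_le Pg ν hsq
      _ = _ := by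
          rw [← ENNReal.ofReal_mul hC, ← ENNReal.ofReal_add (by positivity) (by positivity),
            ← ENNReal.ofReal_add (by positivity) (by positivity)]
          congr 1
          ring
  exact ⟨⟨γ, hγ1, hγ2, hcost⟩, (iInf₂_le γ ⟨hγ1, hγ2⟩).trans hcost⟩
end

section
/- Let M and P be embedded C¹ submanifolds of ℝ^d (second countable, without boundary) of dimensions m and p with m + p < d, and let η and η′ be independent absolutely continuous ℝ^d-valued random vectors. Then with probability 1 the perturbed sets M̃ = M + η and P̃ = P + η′ do not intersect: P_{η,η′}((M + η) ∩ (P + η′) = ∅) = 1. -/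
open MeasureTheory ProbabilityTheory
open scoped Pointwise

/-- `S` is an embedded `C¹` submanifold of `ℝ^d` of dimension `m` (without boundary):
every point of `S` has a relatively open neighbourhood `S ∩ V` which is the image of an
open set `U ⊆ ℝ^m` under a `C¹` immersion. (Subsets of `ℝ^d` are automatically second
countable.) -/
def IsC1Submanifold (m d : ℕ) (S : Set (EuclideanSpace ℝ (Fin d))) : Prop :=
  ∀ x ∈ S, ∃ (U : Set (EuclideanSpace ℝ (Fin m)))
    (f : EuclideanSpace ℝ (Fin m) → EuclideanSpace ℝ (Fin d))
    (V : Set (EuclideanSpace ℝ (Fin d))),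
      IsOpen U ∧ IsOpen V ∧ x ∈ V ∧ ContDiffOn ℝ 1 f U ∧
      (∀ u ∈ U, Function.Injective (fderiv ℝ f u)) ∧
      f '' U = S ∩ V

open Module in
theorem ContDiffOn.dimH_image_le_of_isOpen {E F : Type*}
    [NormedAddCommGroup E] [NormedSpace ℝ E] [FiniteDimensional ℝ E]
    [NormedAddCommGroup F] [NormedSpace ℝ F] {f : E → F} {s : Set E}
    (hf : ContDiffOn ℝ 1 f s) (hs : IsOpen s) : dimH (f '' s) ≤ finrank ℝ E := by
  refine (dimH_image_le_of_locally_lipschitzOn fun x hx => ?_).trans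
    ((dimH_mono s.subset_univ).trans_eq (Real.dimH_univ_eq_finrank E))
  obtain ⟨K, t, ht, hK⟩ := (hf.contDiffAt (hs.mem_nhds hx)).exists_lipschitzOnWith
  exact ⟨K, t, mem_nhdsWithin_of_mem_nhds ht, hK⟩

theorem dimH_le_of_forall_exists_mem_nhdsWithin {X : Type*} [EMetricSpace X]
    [SecondCountableTopology X] {s : Set X} {r : ENNReal}
    (h : ∀ x ∈ s, ∃ t ∈ nhdsWithin x s, dimH t ≤ r) : dimH s ≤ r := by
  by_contra! hr
  obtain ⟨x, hx, hlt⟩ := exists_mem_nhdsWithin_lt_dimH_of_lt_dimH hr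
  obtain ⟨t, ht, hle⟩ := h x hx
  exact (hlt t ht).not_ge hle

theorem IsC1Submanifold.dimH_prod_le {m p d e : ℕ} {M : Set (EuclideanSpace ℝ (Fin d))}
    {P : Set (EuclideanSpace ℝ (Fin e))} (hM : IsC1Submanifold m d M)
    (hP : IsC1Submanifold p e P) : dimH (M ×ˢ P) ≤ (m + p : ℕ) := by
  refine dimH_le_of_forall_exists_mem_nhdsWithin fun ⟨x, y⟩ ⟨hx, hy⟩ => ?_
  obtain ⟨U, f, V, hU, hV, hxV, hf, -, hfU⟩ := hM x hx
  obtain ⟨U', g, V', hU', hV', hyV', hg, -, hgU'⟩ := hP y hy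
  refine ⟨(M ∩ V) ×ˢ (P ∩ V'), ?_, ?_⟩
  · rw [nhdsWithin_prod_eq]
    exact Filter.prod_mem_prod
      (Filter.inter_mem self_mem_nhdsWithin (mem_nhdsWithin_of_mem_nhds (hV.mem_nhds hxV)))
      (Filter.inter_mem self_mem_nhdsWithin (mem_nhdsWithin_of_mem_nhds (hV'.mem_nhds hyV')))
  · rw [← hfU, ← hgU', ← Set.prodMap_image_prod]
    simpa using (hf.prodMap hg).dimH_image_le_of_isOpen (hU.prod hU')

theorem volume_eq_zero_of_dimH_lt {d : ℕ} {s : Set (EuclideanSpace ℝ (Fin d))}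
    (hs : dimH s < d) : volume s = 0 := by
  have : (Measure.hausdorffMeasure (d : ℝ) :
      Measure (EuclideanSpace ℝ (Fin d))).IsAddHaarMeasure := by
    simpa using isAddHaarMeasure_hausdorffMeasure (E := EuclideanSpace ℝ (Fin d))
  exact measure_zero_of_dimH_lt (d := (d : NNReal))
    (by simpa using Measure.absolutelyContinuous_isAddHaarMeasure volume _) (by simpa using hs)

theorem IsC1Submanifold.volume_sub_eq_zero {m p d : ℕ} {M P : Set (EuclideanSpace ℝ (Fin d))}
    (hM : IsC1Submanifold m d M) (hP : IsC1Submanifold p d P) (hdim : m + p < d) :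
    volume (M - P) = 0 := by
  refine volume_eq_zero_of_dimH_lt ?_
  rw [← Set.sub_image_prod]
  calc dimH ((fun z : EuclideanSpace ℝ (Fin d) × EuclideanSpace ℝ (Fin d) => z.1 - z.2) '' M ×ˢ P)
      ≤ dimH (M ×ˢ P) := (LipschitzWith.prod_fst.sub LipschitzWith.prod_snd).dimH_image_le _
    _ ≤ (m + p : ℕ) := hM.dimH_prod_le hP
    _ < d := by exact_mod_cast hdim

theorem ProbabilityTheory.IndepFun.ae_sub_notMem {Ω G : Type*} [MeasurableSpace Ω]
    [AddGroup G] [MeasurableSpace G] [MeasurableAdd₂ G] [MeasurableNeg G]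
    {μ : Measure Ω} [IsFiniteMeasure μ] {ν : Measure G} [SFinite ν] [ν.IsAddLeftInvariant]
    {X Y : Ω → G} (h : IndepFun X Y μ) (hX : Measurable X) (hY : Measurable Y)
    (hac : μ.map Y ≪ ν) {N : Set G} (hN : ν N = 0) : ∀ᵐ ω ∂μ, X ω - Y ω ∉ N := by
  have hmeas : MeasurableSet {z : G × G | z.1 - z.2 ∈ toMeasurable ν N} :=
    measurable_sub (measurableSet_toMeasurable ν N)
  have hnull : (μ.map fun ω => (X ω, Y ω)) {z | z.1 - z.2 ∈ toMeasurable ν N} = 0 := by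
    rw [(indepFun_iff_map_prod_eq_prod_map_map hX.aemeasurable hY.aemeasurable).1 h,
      Measure.measure_prod_null hmeas]
    refine Filter.Eventually.of_forall fun x => hac ?_
    exact (quasiMeasurePreserving_sub_left ν x).preimage_null
      ((measure_toMeasurable N).trans hN)
  rw [Measure.map_apply (hX.prodMk hY) hmeas] at hnull
  filter_upwards [measure_eq_zero_iff_ae_notMem.1 hnull] with ω hω hmem
  exact hω (subset_toMeasurable ν N hmem)

/-- **Randomly perturbed low-dimensional submanifolds almost surely do not intersect.**
If `M` and `P` are embedded `C¹` submanifolds of `ℝ^d` of dimensions `m` and `p` with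
`m + p < d`, and `η, η′` are independent absolutely continuous random vectors in `ℝ^d`,
then with probability 1 the perturbed sets `M̃ = M + η` and `P̃ = P + η′` are disjoint. -/
theorem perturbed_lowdim_submanifolds_ae_disjoint {m p d : ℕ}
    {Ω : Type*} [MeasurableSpace Ω] (μ : Measure Ω) [IsProbabilityMeasure μ]
    (M P : Set (EuclideanSpace ℝ (Fin d)))
    (hM : IsC1Submanifold m d M) (hP : IsC1Submanifold p d P)
    (hdim : m + p < d)
    (η η' : Ω → EuclideanSpace ℝ (Fin d))
    (hη : Measurable η) (hη' : Measurable η')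
    (hindep : IndepFun η η' μ)
    (hacη : Measure.map η μ ≪ volume) (hacη' : Measure.map η' μ ≪ volume) :
    μ {ω | (M + {η ω}) ∩ (P + {η' ω}) = ∅} = 1 := by
  have hnull : volume (P - M) = 0 := hP.volume_sub_eq_zero hM (by lia)
  have hae : ∀ᵐ ω ∂μ, (M + {η ω}) ∩ (P + {η' ω}) = ∅ := by
    filter_upwards [hindep.ae_sub_notMem hη hη' hacη' hnull] with ω hω
    rw [Set.eq_empty_iff_forall_notMem]
    rintro z ⟨⟨x, hx, _, rfl, hxz⟩, y, hy, _, rfl, hyz⟩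
    refine hω ⟨y, hy, x, hx, ?_⟩
    exact sub_eq_sub_iff_add_eq_add.2 (hyz.trans (hxz.symm.trans (add_comm _ _)))
  rw [measure_congr (Filter.eventuallyEq_univ.2 hae), measure_univ]
end

section
/- Let P_r and P_g be probability measures on ℝ^d that are absolutely continuous with densities p_r and p_g with respect to Lebesgue measure. Then the discriminator objective L(D) = E_{x∼P_r}[log D(x)] + E_{x∼P_g}[log(1 − D(x))] over measurable D : ℝ^d → [0,1] is maximized by D*(x) = p_r(x)/(p_r(x) + p_g(x)) (defined arbitrarily where p_r + p_g = 0), and the maximal value is L(D*) = 2·JSD(P_r ‖ P_g) − 2·log 2. -/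
open MeasureTheory
open scoped ENNReal

open scoped Classical in
/-- `−log t` as an extended nonnegative real, for `t ∈ [0,1]` (with `−log 0 = ∞`). -/
noncomputable def negLog (t : ℝ) : ℝ≥0∞ :=
  if t = 0 then ⊤ else ENNReal.ofReal (-Real.log t)

/-- For a discriminator `D : ℝ^d → [0,1]`, the negated GAN objective
`−L(D) = −E_{x∼P_r}[log D(x)] − E_{x∼P_g}[log(1−D(x))]`, valued in `[0,∞]`; since
`L(D) ∈ [−∞,0]`, `D` maximizes `L` iff it minimizes `negGanLoss`. -/
noncomputable def negGanLoss {d : ℕ}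
    (Pr Pg : Measure (EuclideanSpace ℝ (Fin d)))
    (D : EuclideanSpace ℝ (Fin d) → ℝ) : ℝ≥0∞ :=
  (∫⁻ x, negLog (D x) ∂Pr) + ∫⁻ x, negLog (1 - D x) ∂Pg

lemma negLog_one : negLog 1 = 0 := by simp [negLog]

lemma negLog_zero : negLog 0 = ⊤ := by simp [negLog]

lemma negLog_of_ne_zero {t : ℝ} (ht : t ≠ 0) : negLog t = ENNReal.ofReal (-Real.log t) := by
  simp [negLog, ht]

lemma measurable_negLog : Measurable negLog := by
  unfold negLog
  exact Measurable.ite (measurableSet_singleton 0) measurable_const (by fun_prop)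

/-- Gibbs' inequality for two-point distributions, with unnormalized weights. -/
lemma mul_neg_log_add_mul_neg_log_le {p q t : ℝ} (hp : 0 < p) (hq : 0 < q)
    (ht0 : 0 < t) (ht1 : t < 1) :
    p * -Real.log (p / (p + q)) + q * -Real.log (q / (p + q)) ≤
      p * -Real.log t + q * -Real.log (1 - t) := by
  have hs : 0 < 1 - t := by linarith
  have hpq : 0 < p + q := by linarith
  have h1 := Real.log_le_sub_one_of_pos (div_pos ht0 (div_pos hp hpq))
  have h2 := Real.log_le_sub_one_of_pos (div_pos hs (div_pos hq hpq))
  rw [Real.log_div ht0.ne' (div_pos hp hpq).ne'] at h1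
  rw [Real.log_div hs.ne' (div_pos hq hpq).ne'] at h2
  have h3 := add_le_add (mul_le_mul_of_nonneg_left h1 hp.le) (mul_le_mul_of_nonneg_left h2 hq.le)
  have h4 : p * (t / (p / (p + q)) - 1) + q * ((1 - t) / (q / (p + q)) - 1) = 0 := by
    field_simp
    ring
  linarith

lemma ofReal_mul_negLog_add_le {p q s t : ℝ} (hp : 0 ≤ p) (hq : 0 ≤ q)
    (hs : p + q ≠ 0 → s = p / (p + q)) (ht : t ∈ Set.Icc (0 : ℝ) 1) :
    ENNReal.ofReal p * negLog s + ENNReal.ofReal q * negLog (1 - s) ≤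
      ENNReal.ofReal p * negLog t + ENNReal.ofReal q * negLog (1 - t) := by
  rcases hp.eq_or_lt with rfl | hp
  · rcases hq.eq_or_lt with rfl | hq
    · simp
    · have : s = 0 := by simpa using hs (by linarith)
      simp [this, negLog_one]
  rcases hq.eq_or_lt with rfl | hq
  · have : s = 1 := by simpa [hp.ne'] using hs (by linarith)
    simp [this, negLog_one]
  rcases ht.1.eq_or_lt with rfl | ht0
  · simp [negLog_zero, ENNReal.mul_top, hp]
  rcases ht.2.eq_or_lt with rfl | ht1
  · simp [negLog_zero, ENNReal.mul_top, hq]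
  have hpq : 0 < p + q := by linarith
  have hs := hs hpq.ne'
  have hs' : 1 - s = q / (p + q) := by
    rw [hs]
    field_simp
    ring
  have hlog {a : ℝ} (h0 : 0 ≤ a) (h1 : a ≤ 1) : 0 ≤ -Real.log a :=
    neg_nonneg.2 (Real.log_nonpos h0 h1)
  have hs1 : p / (p + q) ≤ 1 := (div_le_one hpq).2 (by linarith)
  have hs2 : q / (p + q) ≤ 1 := (div_le_one hpq).2 (by linarith)
  have hsp : 0 < p / (p + q) := by positivity
  have hsq : 0 < q / (p + q) := by positivity
  rw [hs', hs, negLog_of_ne_zero hsp.ne', negLog_of_ne_zero hsq.ne', negLog_of_ne_zero ht0.ne',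
    negLog_of_ne_zero (sub_pos.2 ht1).ne', ← ENNReal.ofReal_mul hp.le, ← ENNReal.ofReal_mul hq.le,
    ← ENNReal.ofReal_mul hp.le, ← ENNReal.ofReal_mul hq.le,
    ← ENNReal.ofReal_add (mul_nonneg hp.le (hlog hsp.le hs1))
      (mul_nonneg hq.le (hlog hsq.le hs2)),
    ← ENNReal.ofReal_add (mul_nonneg hp.le (hlog ht0.le ht1.le))
      (mul_nonneg hq.le (hlog (by linarith) (by linarith)))]
  exact ENNReal.ofReal_le_ofReal (mul_neg_log_add_mul_neg_log_le hp hq ht0 ht1)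

lemma negGanLoss_withDensity {d : ℕ} (μ : Measure (EuclideanSpace ℝ (Fin d)))
    {p q D : EuclideanSpace ℝ (Fin d) → ℝ} (hp : Measurable p) (hq : Measurable q)
    (hD : Measurable D) :
    negGanLoss (μ.withDensity fun x => ENNReal.ofReal (p x))
        (μ.withDensity fun x => ENNReal.ofReal (q x)) D =
      ∫⁻ x, ENNReal.ofReal (p x) * negLog (D x) + ENNReal.ofReal (q x) * negLog (1 - D x) ∂μ := by
  have h1 : Measurable fun x => negLog (D x) := measurable_negLog.comp hD
  have h2 : Measurable fun x => negLog (1 - D x) := measurable_negLog.comp (hD.const_sub 1)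
  rw [negGanLoss, lintegral_withDensity_eq_lintegral_mul _ hp.ennreal_ofReal h1,
    lintegral_withDensity_eq_lintegral_mul _ hq.ennreal_ofReal h2,
    ← lintegral_add_left (hp.ennreal_ofReal.mul h1)]
  rfl

/-- If `μ` has density `2 f` with respect to `ν`, where `f` is `[0,1]`-valued, then
`E_μ[-log f]` and `KL(μ‖ν)` add up to `log 2`. -/
lemma lintegral_negLog_add_KLdiv {α : Type*} [MeasurableSpace α] {μ ν : Measure α}
    [IsProbabilityMeasure μ] [IsProbabilityMeasure ν] {f : α → ℝ} (hf : Measurable f)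
    (hf01 : ∀ x, f x ∈ Set.Icc (0 : ℝ) 1)
    (hμ : μ = ν.withDensity fun x => ENNReal.ofReal (2 * f x)) :
    ∫⁻ x, negLog (f x) ∂μ + KLdiv μ ν = ENNReal.ofReal (Real.log 2) := by
  have hdens : Measurable fun x => ENNReal.ofReal (2 * f x) := (hf.const_mul 2).ennreal_ofReal
  have hac : μ ≪ ν := hμ ▸ withDensity_absolutelyContinuous _ _
  have hrn : μ.rnDeriv ν =ᵐ[ν] fun x => ENNReal.ofReal (2 * f x) := by
    rw [hμ]
    exact Measure.rnDeriv_withDensity ν hdens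
  have hpos : ∀ᵐ x ∂μ, 0 < f x := by
    rw [hμ, ae_withDensity_iff hdens]
    refine ae_of_all _ fun x hx => ?_
    simpa using hx
  have hllr : llr μ ν =ᵐ[μ] fun x => Real.log 2 + Real.log (f x) := by
    filter_upwards [hac.ae_le hrn, hpos] with x hx hx0
    rw [llr, hx, ENNReal.toReal_ofReal (by positivity), Real.log_mul two_ne_zero hx0.ne']
  have hint : Integrable (llr μ ν) μ := by
    rw [← InformationTheory.integrable_klFun_rnDeriv_iff hac]
    refine Integrable.of_bound (C := 1)
      (by fun_prop : Measurable fun x =>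
        InformationTheory.klFun (μ.rnDeriv ν x).toReal).aestronglyMeasurable ?_
    filter_upwards [hrn] with x hx
    obtain ⟨h0, h1⟩ := hf01 x
    rw [hx, ENNReal.toReal_ofReal (by positivity), Real.norm_of_nonneg
      (InformationTheory.klFun_nonneg (by positivity)), InformationTheory.klFun_apply]
    rcases h0.eq_or_lt with h0 | h0
    · simp [← h0]
    · have := mul_le_mul_of_nonneg_left
        (Real.log_le_sub_one_of_pos (by positivity : 0 < 2 * f x)) (by positivity : 0 ≤ 2 * f x)
      nlinarith
  have hlog : Integrable (fun x => Real.log (f x)) μ := by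
    refine ((hint.congr hllr).sub (integrable_const (Real.log 2))).congr (ae_of_all _ fun x => ?_)
    simp
  have hnn : 0 ≤ ∫ x, llr μ ν x ∂μ := by
    simpa using InformationTheory.integral_llr_add_sub_measure_univ_nonneg hac hint
  have hlog_nonneg (x : α) : 0 ≤ -Real.log (f x) :=
    neg_nonneg.2 (Real.log_nonpos (hf01 x).1 (hf01 x).2)
  have hloss : ∫⁻ x, negLog (f x) ∂μ = ENNReal.ofReal (∫ x, -Real.log (f x) ∂μ) := by
    rw [ofReal_integral_eq_lintegral_ofReal hlog.fun_neg (ae_of_all _ hlog_nonneg)]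
    refine lintegral_congr_ae ?_
    filter_upwards [hpos] with x hx using negLog_of_ne_zero hx.ne'
  rw [hloss, KLdiv, if_pos ⟨hac, hint⟩,
    ← ENNReal.ofReal_add (integral_nonneg hlog_nonneg) hnn, integral_congr_ae hllr,
    integral_add (integrable_const _) hlog, integral_neg]
  simp

lemma withDensity_eq_withDensity_two_mul {α : Type*} [MeasurableSpace α] (μ : Measure α)
    {p q f : α → ℝ} (hp : Measurable p) (hq : Measurable q) (hp0 : ∀ x, 0 ≤ p x)
    (hq0 : ∀ x, 0 ≤ q x) (hf : Measurable f) (hfp : ∀ x, (p x + q x) * f x = p x) :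
    (μ.withDensity fun x => ENNReal.ofReal (p x)) =
      ((2 : ℝ≥0∞)⁻¹ • ((μ.withDensity fun x => ENNReal.ofReal (p x)) +
        μ.withDensity fun x => ENNReal.ofReal (q x))).withDensity
          fun x => ENNReal.ofReal (2 * f x) := by
  rw [← withDensity_add_left hp.ennreal_ofReal, withDensity_smul_measure,
    ← withDensity_mul _ (hp.ennreal_ofReal.add hq.ennreal_ofReal) (hf.const_mul 2).ennreal_ofReal,
    ← withDensity_smul _ ((hp.ennreal_ofReal.add hq.ennreal_ofReal).mul
      (hf.const_mul 2).ennreal_ofReal)]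
  congr 1
  ext x
  have h2 : (2 : ℝ≥0∞)⁻¹ = ENNReal.ofReal 2⁻¹ := by
    rw [ENNReal.ofReal_inv_of_pos two_pos, ENNReal.ofReal_ofNat]
  simp only [Pi.smul_apply, Pi.mul_apply, Pi.add_apply, smul_eq_mul]
  rw [← ENNReal.ofReal_add (hp0 x) (hq0 x), ← ENNReal.ofReal_mul (add_nonneg (hp0 x) (hq0 x)), h2,
    ← ENNReal.ofReal_mul (by norm_num)]
  congr 1
  linarith [hfp x]

/-- **The optimal discriminator and the value of the GAN objective.**
Let `P_r`, `P_g` have Lebesgue densities `p_r`, `p_g`, and let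
`D*(x) = p_r(x)/(p_r(x) + p_g(x))` wherever `p_r(x) + p_g(x) ≠ 0` (arbitrary in `[0,1]`
elsewhere). Then `D*` maximizes `L(D) = E_{P_r}[log D] + E_{P_g}[log(1−D)]` over all
measurable `D : ℝ^d → [0,1]` (equivalently, minimizes `−L`), and
`L(D*) = 2·JSD(P_r‖P_g) − 2·log 2`, i.e. `−L(D*) = 2·log 2 − 2·JSD(P_r‖P_g)`. -/
theorem optimal_discriminator_and_value {d : ℕ}
    (Pr Pg : Measure (EuclideanSpace ℝ (Fin d)))
    [IsProbabilityMeasure Pr] [IsProbabilityMeasure Pg]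
    (pr pg : EuclideanSpace ℝ (Fin d) → ℝ)
    (hpr_meas : Measurable pr) (hpg_meas : Measurable pg)
    (hpr_nonneg : ∀ x, 0 ≤ pr x) (hpg_nonneg : ∀ x, 0 ≤ pg x)
    (hPr : Pr = volume.withDensity fun x => ENNReal.ofReal (pr x))
    (hPg : Pg = volume.withDensity fun x => ENNReal.ofReal (pg x))
    (Dstar : EuclideanSpace ℝ (Fin d) → ℝ)
    (hDstar_meas : Measurable Dstar)
    (hDstar_mem : ∀ x, Dstar x ∈ Set.Icc (0 : ℝ) 1)
    (hDstar : ∀ x, pr x + pg x ≠ 0 → Dstar x = pr x / (pr x + pg x)) :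
    (∀ D : EuclideanSpace ℝ (Fin d) → ℝ, Measurable D →
      (∀ x, D x ∈ Set.Icc (0 : ℝ) 1) →
      negGanLoss Pr Pg Dstar ≤ negGanLoss Pr Pg D) ∧
    negGanLoss Pr Pg Dstar = ENNReal.ofReal (2 * Real.log 2) - 2 * JSdiv Pr Pg := by
  have hone (x) : 1 - Dstar x ∈ Set.Icc (0 : ℝ) 1 :=
    ⟨by linarith [(hDstar_mem x).2], by linarith [(hDstar_mem x).1]⟩
  have hmul (x) : (pr x + pg x) * Dstar x = pr x := by
    by_cases h : pr x + pg x = 0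
    · rw [h, zero_mul]
      linarith [hpr_nonneg x, hpg_nonneg x]
    · rw [hDstar x h, mul_div_cancel₀ _ h]
  refine ⟨fun D hD hD01 => ?_, ?_⟩
  · rw [hPr, hPg, negGanLoss_withDensity _ hpr_meas hpg_meas hDstar_meas,
      negGanLoss_withDensity _ hpr_meas hpg_meas hD]
    exact lintegral_mono fun x =>
      ofReal_mul_negLog_add_le (hpr_nonneg x) (hpg_nonneg x) (hDstar x) (hD01 x)
  have hprob : IsProbabilityMeasure ((2 : ℝ≥0∞)⁻¹ • (Pr + Pg)) := ⟨by
    simp [ENNReal.inv_two_add_inv_two]⟩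
  have h1 := lintegral_negLog_add_KLdiv (μ := Pr) (ν := (2 : ℝ≥0∞)⁻¹ • (Pr + Pg)) hDstar_meas
    hDstar_mem (by
      rw [hPr, hPg]
      exact withDensity_eq_withDensity_two_mul _ hpr_meas hpg_meas hpr_nonneg hpg_nonneg
        hDstar_meas hmul)
  have h2 := lintegral_negLog_add_KLdiv (μ := Pg) (ν := (2 : ℝ≥0∞)⁻¹ • (Pr + Pg))
    (hDstar_meas.const_sub 1) hone (by
      rw [hPr, hPg, add_comm (volume.withDensity fun x => ENNReal.ofReal (pr x))]
      exact withDensity_eq_withDensity_two_mul _ hpg_meas hpr_meas hpg_nonneg hpr_nonneg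
        (hDstar_meas.const_sub 1) fun x => by linarith [hmul x])
  have hJS : 2 * JSdiv Pr Pg = KLdiv Pr ((2 : ℝ≥0∞)⁻¹ • (Pr + Pg)) +
      KLdiv Pg ((2 : ℝ≥0∞)⁻¹ • (Pr + Pg)) := by
    rw [JSdiv, mul_add, ← mul_assoc, ← mul_assoc,
      ENNReal.mul_inv_cancel two_ne_zero ENNReal.ofNat_ne_top, one_mul, one_mul]
  have hsum : negGanLoss Pr Pg Dstar + 2 * JSdiv Pr Pg = ENNReal.ofReal (2 * Real.log 2) := by
    have hlog2 := Real.log_nonneg one_le_two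
    rw [hJS, negGanLoss, add_add_add_comm, h1, h2, ← ENNReal.ofReal_add hlog2 hlog2, two_mul]
  exact ENNReal.eq_sub_of_add_eq
    (ne_top_of_le_ne_top ENNReal.ofReal_ne_top (hsum ▸ le_add_self)) hsum
end
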